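/- Let N and L be positive integers, let S be an N x N positive definite Hermitian complex matrix, let Z be an N x L complex matrix, and let p be a nonzero vector in C^N. Define kappa(p) = 1/(p^H S^{-1} p), alpha_hat = kappa(p) * (p^H S^{-1} Z)^T, u = Z^H S^{-1} p, and X = I_L + Z^H S^{-1} Z. Then det(Z * Z^H + S) / det(S + (Z - p * alpha_hat^T)(Z - p * alpha_hat^T)^H) = 1 / (1 - kappa(p) * u^H X^{-1} u). -/

import Mathlib

open Matrix
open scoped ComplexOrder

/-- The rank-one matrix determinant lemma for `A - c • w vᵀ`. -/
theorem det_sub_smul_vecMulVec {n R : Type*} [Fintype n] [DecidableEq n] [CommRing R]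
    {A : Matrix n n R} (hA : IsUnit A.det) (c : R) (w v : n → R) :
    (A - c • vecMulVec w v).det = A.det * (1 - c * (v ⬝ᵥ A⁻¹ *ᵥ w)) := by
  have h := det_add_replicateCol_mul_replicateRow (ι := Unit) hA (-(c • w)) v
  rw [← vecMulVec_eq, neg_vecMulVec, smul_vecMulVec, ← sub_eq_add_neg] at h
  rw [h, det_unique (1 + _), Matrix.mul_assoc, ← replicateCol_mulVec, Matrix.add_apply,
    replicateRow_mul_replicateCol_apply, mulVec_neg, mulVec_smul, dotProduct_neg, dotProduct_smul]
  simp [sub_eq_add_neg]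

/-- Removing the weighted least-squares projection onto `p` from the columns of `Z` subtracts a
rank-one matrix from the Gram matrix `Zᴴ T Z`. -/
theorem conjTranspose_mul_mul_sub_vecMulVec {m n K : Type*} [Fintype m] [Field K] [StarRing K]
    {T : Matrix m m K} (hT : T.IsHermitian) (Z : Matrix m n K) {p : m → K}
    (hp : star p ⬝ᵥ T *ᵥ p ≠ 0) :
    let κ := (star p ⬝ᵥ T *ᵥ p)⁻¹
    let u := (Zᴴ * T) *ᵥ p
    (Z - vecMulVec p (κ • star u))ᴴ * T * (Z - vecMulVec p (κ • star u))
      = Zᴴ * T * Z - κ • vecMulVec u (star u) := by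
  intro κ u
  have hq : star (star p ⬝ᵥ T *ᵥ p) = star p ⬝ᵥ T *ᵥ p := by
    rw [← star_dotProduct, star_mulVec, hT.eq, ← dotProduct_mulVec]
  have hκ : star κ = κ := by simp only [κ, star_inv₀, hq]
  have hκq : κ * (star p ⬝ᵥ T *ᵥ p) = 1 := inv_mul_cancel₀ hp
  have hu : star p ᵥ* (T * Z) = star u := by
    simp only [u, star_mulVec, conjTranspose_mul, hT.eq, conjTranspose_conjTranspose]
  have hright : Zᴴ * T * vecMulVec p (star u) = vecMulVec u (star u) := mul_vecMulVec ..
  have hleft : vecMulVec u (star p) * T * Z = vecMulVec u (star u) := by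
    rw [Matrix.mul_assoc, vecMulVec_mul, hu]
  have hboth : vecMulVec u (star p) * T * vecMulVec p (star u)
      = (star p ⬝ᵥ T *ᵥ p) • vecMulVec u (star u) := by
    rw [vecMulVec_mul, vecMulVec_mul_vecMulVec, ← dotProduct_mulVec, vecMulVec_smul]
  rw [vecMulVec_smul, conjTranspose_sub, conjTranspose_smul, conjTranspose_vecMulVec, star_star,
    hκ, Matrix.sub_mul, Matrix.sub_mul, Matrix.mul_sub, Matrix.mul_sub, Matrix.smul_mul,
    Matrix.smul_mul, Matrix.smul_mul, Matrix.mul_smul, Matrix.mul_smul, hright, hleft, hboth,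
    smul_smul κ (star p ⬝ᵥ T *ᵥ p), hκq, one_smul, sub_self, sub_zero]

/-- The GLRT determinant ratio equals `1/(1 - κ(p) uᴴ X⁻¹ u)`:
`det(Z Zᴴ + S) / det(S + (Z - p α̂ᵀ)(Z - p α̂ᵀ)ᴴ) = 1/(1 - κ(p) uᴴ X⁻¹ u)`. -/
theorem glrt_det_ratio_eq
    (N L : ℕ) (hN : 0 < N) (hL : 0 < L)
    (S : Matrix (Fin N) (Fin N) ℂ) (hS : S.PosDef)
    (Z : Matrix (Fin N) (Fin L) ℂ)
    (p : Fin N → ℂ) (hp : p ≠ 0)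
    (κ : ℂ) (hκ : κ = (star p ⬝ᵥ S⁻¹ *ᵥ p)⁻¹)
    (αhat : Fin L → ℂ) (hα : αhat = κ • (star p ᵥ* (S⁻¹ * Z)))
    (u : Fin L → ℂ) (hu : u = (Zᴴ * S⁻¹) *ᵥ p)
    (X : Matrix (Fin L) (Fin L) ℂ) (hX : X = 1 + Zᴴ * S⁻¹ * Z) :
    (Z * Zᴴ + S).det / (S + (Z - vecMulVec p αhat) * (Z - vecMulVec p αhat)ᴴ).det
      = 1 / (1 - κ * (star u ⬝ᵥ X⁻¹ *ᵥ u)) := by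
  have hSdet : S.det ≠ 0 := hS.det_pos.ne'
  have hXdet : X.det ≠ 0 := by
    rw [hX]
    exact (PosDef.one.add_posSemidef
      (hS.inv.posSemidef.conjTranspose_mul_mul_same Z)).det_pos.ne'
  have hα' : αhat = κ • star u := by
    rw [hα, hu, star_mulVec, conjTranspose_mul, hS.inv.isHermitian.eq,
      conjTranspose_conjTranspose]
  have hgram := conjTranspose_mul_mul_sub_vecMulVec hS.inv.isHermitian Z
    (hS.inv.dotProduct_mulVec_pos hp).ne'
  simp only [← hκ, ← hu, ← hα'] at hgram
  rw [add_comm (Z * Zᴴ), det_add_mul _ _ hSdet.isUnit, det_add_mul _ _ hSdet.isUnit, hgram,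
    ← add_sub_assoc, ← hX, det_sub_smul_vecMulVec hXdet.isUnit, ← mul_assoc,
    div_mul_eq_div_div, div_self (mul_ne_zero hSdet hXdet)]
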